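/- arXiv:1705.07649 — 4 statements merged into one kernel-verified Lean document; each statement's English description precedes it below -/
import Mathlib

section
/- Let a, b, c be affinely independent points of the Euclidean plane ℝ², let o be the circumcenter and ρ the circumradius of the triangle with vertices a, b, c. Let z be a point with dist z o ≤ ρ such that z and a do not lie strictly on the same side of the line through b and c (i.e. z lies in the convex hull of the arc of the circumcircle cut off by the chord bc on the side opposite to a). Set θ₁ = ∠ b a z and θ₂ = ∠ z a c (unsigned angles at vertex a), and assume θ₁ > 0, θ₂ > 0 and θ₁ + θ₂ = ∠ b a c. Then dist b z · θ₁ / sin θ₁ + dist z c · θ₂ / sin θ₂ ≤ dist b c · (θ₁ + θ₂) / sin (θ₁ + θ₂). -/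
open EuclideanGeometry Real

/-- If the angles from `z` to `x` and to `y` add up to the angle from `x` to `y`, then `z` is the
combination of `x` and `y` given by the sine rule. -/
theorem sin_smul_normalize_eq_of_angle_add_angle_eq
    {V : Type*} [NormedAddCommGroup V] [InnerProductSpace ℝ V] {x y z : V}
    (hx : x ≠ 0) (hy : y ≠ 0) (hz : z ≠ 0)
    (h : InnerProductGeometry.angle x z + InnerProductGeometry.angle z y =
      InnerProductGeometry.angle x y) :
    Real.sin (InnerProductGeometry.angle x z + InnerProductGeometry.angle z y) • (‖z‖⁻¹ • z) =
      Real.sin (InnerProductGeometry.angle z y) • (‖x‖⁻¹ • x) +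
        Real.sin (InnerProductGeometry.angle x z) • (‖y‖⁻¹ • y) := by
  have hx' : ‖x‖ ≠ 0 := norm_ne_zero_iff.2 hx
  have hy' : ‖y‖ ≠ 0 := norm_ne_zero_iff.2 hy
  have hz' : ‖z‖ ≠ 0 := norm_ne_zero_iff.2 hz
  have hxz := InnerProductGeometry.cos_angle_mul_norm_mul_norm x z
  have hzy := InnerProductGeometry.cos_angle_mul_norm_mul_norm z y
  have hxy := InnerProductGeometry.cos_angle_mul_norm_mul_norm x y
  rw [← h] at hxy
  set α := InnerProductGeometry.angle x z
  set β := InnerProductGeometry.angle z y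
  rw [← sub_eq_zero, ← inner_self_eq_zero (𝕜 := ℝ)]
  simp only [inner_sub_left, inner_sub_right, inner_add_left, inner_add_right,
    real_inner_smul_left, real_inner_smul_right]
  simp only [real_inner_self_eq_norm_sq, real_inner_comm x z, real_inner_comm z y,
    real_inner_comm x y, ← hxz, ← hzy, ← hxy]
  field_simp
  rw [Real.sin_add, Real.cos_add]
  have hα := Real.sin_sq_add_cos_sq α
  have hβ := Real.sin_sq_add_cos_sq β
  grind

/-- The function `θ ↦ sin θ / θ` is antitone on `(0, π]`, in product form. -/
theorem Real.mul_sin_le_mul_sin {s t : ℝ} (hs : 0 < s) (hst : s ≤ t) (ht : t ≤ π) :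
    s * Real.sin t ≤ t * Real.sin s := by
  have ht0 : 0 < t := hs.trans_le hst
  have h := strictConcaveOn_sin_Icc.concaveOn.2
    (Set.left_mem_Icc.2 Real.pi_pos.le) (Set.mem_Icc.2 ⟨ht0.le, ht⟩)
    (sub_nonneg.2 ((div_le_one ht0).2 hst)) (by positivity : 0 ≤ s / t) (by ring)
  simp only [smul_eq_mul, Real.sin_zero, mul_zero, zero_add, div_mul_cancel₀ _ ht0.ne'] at h
  calc s * Real.sin t = t * (s / t * Real.sin t) := by field_simp
    _ ≤ t * Real.sin s := by gcongr

/-- The law of sines for the second intersection of a line through a vertex of a triangle with the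
circumcircle, in coordinates: `β` and `γ` are the lengths of the sides at that vertex and
`(sin θ₂ * β + sin θ₁ * γ) / sin (θ₁ + θ₂)` is the length of the chord. -/
theorem sin_sq_mul_sq_dist_second_intersection (β γ θ₁ θ₂ : ℝ)
    (hs : Real.sin (θ₁ + θ₂) ≠ 0) :
    β ^ 2 - 2 * β * ((Real.sin θ₂ * β + Real.sin θ₁ * γ) / Real.sin (θ₁ + θ₂)) * Real.cos θ₁
        + ((Real.sin θ₂ * β + Real.sin θ₁ * γ) / Real.sin (θ₁ + θ₂)) ^ 2 =
      (Real.sin θ₁ / Real.sin (θ₁ + θ₂)) ^ 2 *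
        (β ^ 2 + γ ^ 2 - 2 * β * γ * Real.cos (θ₁ + θ₂)) := by
  field_simp
  rw [Real.sin_add, Real.cos_add]
  have h₁ := Real.sin_sq_add_cos_sq θ₁
  have h₂ := Real.sin_sq_add_cos_sq θ₂
  grind

/-- Arc-length subadditivity at a pole placed at the origin. -/
theorem norm_mul_angle_div_sin_add_le
    {V : Type*} [NormedAddCommGroup V] [InnerProductSpace ℝ V] {x y z o : V} {θ₁ θ₂ : ℝ}
    (hx : x ≠ 0) (hy : y ≠ 0) (hz : z ≠ 0)
    (hθ₁ : θ₁ = InnerProductGeometry.angle x z) (hθ₂ : θ₂ = InnerProductGeometry.angle z y)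
    (hθ₁pos : 0 < θ₁) (hθ₂pos : 0 < θ₂)
    (hsum : θ₁ + θ₂ = InnerProductGeometry.angle x y) (hπ : θ₁ + θ₂ < π)
    (hox : ‖x - o‖ = ‖o‖) (hoy : ‖y - o‖ = ‖o‖) (hoz : ‖z - o‖ ≤ ‖o‖)
    (hside : ∀ p q : ℝ, 0 < p → 0 < q → z = p • x + q • y → 1 ≤ p + q) :
    ‖x - z‖ * θ₁ / Real.sin θ₁ + ‖z - y‖ * θ₂ / Real.sin θ₂ ≤
      ‖x - y‖ * (θ₁ + θ₂) / Real.sin (θ₁ + θ₂) := by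
  have hcomb := sin_smul_normalize_eq_of_angle_add_angle_eq hx hy hz
    (by rw [← hθ₁, ← hθ₂, hsum])
  rw [← hθ₁, ← hθ₂] at hcomb
  have hs₁ : 0 < Real.sin θ₁ := Real.sin_pos_of_pos_of_lt_pi hθ₁pos (by linarith)
  have hs₂ : 0 < Real.sin θ₂ := Real.sin_pos_of_pos_of_lt_pi hθ₂pos (by linarith)
  have hs : 0 < Real.sin (θ₁ + θ₂) := Real.sin_pos_of_pos_of_lt_pi (by linarith) hπ
  have hβ : 0 < ‖x‖ := norm_pos_iff.2 hx
  have hγ : 0 < ‖y‖ := norm_pos_iff.2 hy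
  have ht : 0 < ‖z‖ := norm_pos_iff.2 hz
  have hxz := InnerProductGeometry.cos_angle_mul_norm_mul_norm x z
  have hzy := InnerProductGeometry.cos_angle_mul_norm_mul_norm z y
  have hxy := InnerProductGeometry.cos_angle_mul_norm_mul_norm x y
  rw [← hθ₁] at hxz
  rw [← hθ₂] at hzy
  rw [← hsum] at hxy
  have hm₁ := Real.mul_sin_le_mul_sin hθ₁pos (by linarith : θ₁ ≤ θ₁ + θ₂) hπ.le
  have hm₂ := Real.mul_sin_le_mul_sin hθ₂pos (by linarith : θ₂ ≤ θ₁ + θ₂) hπ.le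
  have hcs := sin_sq_mul_sq_dist_second_intersection ‖x‖ ‖y‖ θ₁ θ₂ hs.ne'
  have hcs' := sin_sq_mul_sq_dist_second_intersection ‖y‖ ‖x‖ θ₂ θ₁
    (by rw [add_comm]; exact hs.ne')
  rw [add_comm θ₂ θ₁] at hcs'
  set s₁ := Real.sin θ₁
  set s₂ := Real.sin θ₂
  set s := Real.sin (θ₁ + θ₂)
  set w : V := ‖z‖⁻¹ • z with hw
  have hzw : z = ‖z‖ • w := by rw [hw, smul_smul, mul_inv_cancel₀ ht.ne', one_smul]
  have hww : ‖w‖ = 1 := by rw [hw, norm_smul, norm_inv, norm_norm, inv_mul_cancel₀ ht.ne']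
  have hwxy : w = (s₂ / (s * ‖x‖)) • x + (s₁ / (s * ‖y‖)) • y := by
    have := congrArg (fun v => s⁻¹ • v) hcomb
    simp only [smul_add, smul_smul, inv_mul_cancel₀ hs.ne', one_smul] at this
    rw [this]
    congr 2 <;> field_simp
  have hxw : inner ℝ x w = ‖x‖ * Real.cos θ₁ := by
    rw [hw, real_inner_smul_right, ← hxz]; field_simp
  have hyw : inner ℝ y w = ‖y‖ * Real.cos θ₂ := by
    rw [hw, real_inner_smul_right, real_inner_comm, ← hzy]; field_simp
  have hxo : inner ℝ x o = ‖x‖ ^ 2 / 2 := by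
    have := norm_sub_sq_real x o
    rw [hox] at this; linarith
  have hyo : inner ℝ y o = ‖y‖ ^ 2 / 2 := by
    have := norm_sub_sq_real y o
    rw [hoy] at this; linarith
  set r₁ := (s₂ * ‖x‖ + s₁ * ‖y‖) / s with hr₁
  set r₀ := s * ‖x‖ * ‖y‖ / (s₂ * ‖y‖ + s₁ * ‖x‖) with hr₀
  have hwo : inner ℝ w o = r₁ / 2 := by
    rw [hwxy, inner_add_left, real_inner_smul_left, real_inner_smul_left, hxo, hyo, hr₁]
    field_simp
  have ht₁ : ‖z‖ ≤ r₁ := by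
    have h1 : ‖z - o‖ ^ 2 ≤ ‖o‖ ^ 2 := by gcongr
    have h2 : inner ℝ z o = ‖z‖ * (r₁ / 2) := by
      rw [← hwo, ← real_inner_smul_left, ← hzw]
    rw [norm_sub_sq_real, h2] at h1
    nlinarith
  have ht₀ : r₀ ≤ ‖z‖ := by
    have h := hside (‖z‖ * (s₂ / (s * ‖x‖))) (‖z‖ * (s₁ / (s * ‖y‖))) (by positivity)
      (by positivity) (by rw [← smul_smul, ← smul_smul, ← smul_add, ← hwxy]; exact hzw)
    rw [hr₀, div_le_iff₀ (by positivity)]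
    calc s * ‖x‖ * ‖y‖ = s * ‖x‖ * ‖y‖ * 1 := by ring
      _ ≤ s * ‖x‖ * ‖y‖ * (‖z‖ * (s₂ / (s * ‖x‖)) + ‖z‖ * (s₁ / (s * ‖y‖))) := by gcongr
      _ = ‖z‖ * (s₂ * ‖y‖ + s₁ * ‖x‖) := by field_simp
  let f : ℝ → ℝ := fun k => ‖x - k • w‖ * (θ₁ / s₁) + ‖y - k • w‖ * (θ₂ / s₂)
  have hconv : ∀ v : V, ConvexOn ℝ Set.univ fun k : ℝ => ‖v - k • w‖ := by
    intro v
    have h := (convexOn_univ_norm (E := V)).comp_affineMap (AffineMap.lineMap v (v - w))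
    refine (h.congr fun k _ => ?_)
    simp [AffineMap.lineMap_apply, sub_eq_add_neg, add_comm]
  have hf : ConvexOn ℝ Set.univ f := by
    have h1 := (hconv x).smul (c := θ₁ / s₁) (by positivity)
    have h2 := (hconv y).smul (c := θ₂ / s₂) (by positivity)
    refine (h1.add h2).congr fun k _ => ?_
    simp [f, mul_comm]
  have hmax := hf.le_max_of_mem_Icc (Set.mem_univ r₀) (Set.mem_univ r₁) ⟨ht₀, ht₁⟩
  have hsqxy : ‖x - y‖ ^ 2 = ‖x‖ ^ 2 + ‖y‖ ^ 2 - 2 * ‖x‖ * ‖y‖ * Real.cos (θ₁ + θ₂) := by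
    rw [norm_sub_sq_real, ← hxy]; ring
  have hfr₁ : f r₁ ≤ ‖x - y‖ * (θ₁ + θ₂) / s := by
    have h1 : ‖x - r₁ • w‖ = s₁ / s * ‖x - y‖ := by
      rw [← sq_eq_sq₀ (by positivity) (by positivity), mul_pow, hsqxy, ← hcs,
        norm_sub_sq_real, real_inner_smul_right, hxw, norm_smul, hww, mul_one, norm_eq_abs,
        sq_abs]
      ring
    have h2 : ‖y - r₁ • w‖ = s₂ / s * ‖x - y‖ := by
      have e : (s₁ * ‖y‖ + s₂ * ‖x‖) / s = r₁ := by rw [hr₁, add_comm]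
      rw [e] at hcs'
      rw [← sq_eq_sq₀ (by positivity) (by positivity), mul_pow, hsqxy,
        norm_sub_sq_real, real_inner_smul_right, hyw, norm_smul, hww, mul_one, norm_eq_abs,
        sq_abs]
      linarith
    simp only [f, h1, h2]
    apply le_of_eq
    field_simp
  have hfr₀ : f r₀ ≤ ‖x - y‖ * (θ₁ + θ₂) / s := by
    set d := s₂ * ‖y‖ + s₁ * ‖x‖ with hd
    have hdpos : 0 < d := by positivity
    have hw₀ : r₀ • w = (s₂ * ‖y‖ / d) • x + (s₁ * ‖x‖ / d) • y := by
      rw [hwxy, smul_add, smul_smul, smul_smul, hr₀]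
      congr 2 <;> field_simp
    have e : s₂ * ‖y‖ / d + s₁ * ‖x‖ / d = 1 := by rw [← add_div, ← hd, div_self hdpos.ne']
    have h1 : ‖x - r₀ • w‖ = s₁ * ‖x‖ / d * ‖x - y‖ := by
      have : x - r₀ • w = (s₁ * ‖x‖ / d) • (x - y) := by
        rw [hw₀, eq_sub_of_add_eq e]; module
      rw [this, norm_smul, Real.norm_of_nonneg (by positivity)]
    have h2 : ‖y - r₀ • w‖ = s₂ * ‖y‖ / d * ‖x - y‖ := by
      have : y - r₀ • w = (s₂ * ‖y‖ / d) • (y - x) := by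
        rw [hw₀, eq_sub_of_add_eq' e]; module
      rw [this, norm_smul, Real.norm_of_nonneg (by positivity), norm_sub_rev]
    have g1 : θ₁ / s₁ ≤ (θ₁ + θ₂) / s := by rwa [div_le_div_iff₀ hs₁ hs]
    have g2 : θ₂ / s₂ ≤ (θ₁ + θ₂) / s := by rwa [div_le_div_iff₀ hs₂ hs]
    simp only [f, h1, h2]
    calc _ ≤ s₁ * ‖x‖ / d * ‖x - y‖ * ((θ₁ + θ₂) / s)
          + s₂ * ‖y‖ / d * ‖x - y‖ * ((θ₁ + θ₂) / s) := by gcongr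
      _ = (s₂ * ‖y‖ / d + s₁ * ‖x‖ / d) * (‖x - y‖ * (θ₁ + θ₂) / s) := by ring
      _ = _ := by rw [e, one_mul]
  have hfz : f ‖z‖ = ‖x - z‖ * θ₁ / s₁ + ‖z - y‖ * θ₂ / s₂ := by
    simp only [f, ← hzw, norm_sub_rev y z]; ring
  rw [← hfz]
  exact hmax.trans (max_le hfr₀ hfr₁)

/-- **Theorem D.2 (paper):** arc-length subadditivity for a point `z` in the convex hull of the
arc `C^a_{bc}` of the circumcircle of the triangle `(a, b, c)` cut off by the chord `bc` on the
side opposite to `a`. -/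
theorem arc_length_subadditive
    (a b c z : EuclideanSpace ℝ (Fin 2))
    (hindep : AffineIndependent ℝ ![a, b, c])
    (o : EuclideanSpace ℝ (Fin 2)) (ρ : ℝ)
    (ho : o = (⟨![a, b, c], hindep⟩ :
      Affine.Simplex ℝ (EuclideanSpace ℝ (Fin 2)) 2).circumcenter)
    (hρ : ρ = (⟨![a, b, c], hindep⟩ :
      Affine.Simplex ℝ (EuclideanSpace ℝ (Fin 2)) 2).circumradius)
    (hz : dist z o ≤ ρ)
    (hside : ¬ (affineSpan ℝ ({b, c} : Set (EuclideanSpace ℝ (Fin 2)))).SSameSide z a)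
    (θ₁ θ₂ : ℝ)
    (hθ₁ : θ₁ = ∠ b a z) (hθ₂ : θ₂ = ∠ z a c)
    (hθ₁pos : 0 < θ₁) (hθ₂pos : 0 < θ₂)
    (hsum : θ₁ + θ₂ = ∠ b a c) :
    dist b z * θ₁ / Real.sin θ₁ + dist z c * θ₂ / Real.sin θ₂ ≤
      dist b c * (θ₁ + θ₂) / Real.sin (θ₁ + θ₂) := by
  have hdist : ∀ i, dist ((![a, b, c] : Fin 3 → EuclideanSpace ℝ (Fin 2)) i) o = ρ := by
    subst ho hρ
    exact fun i => Affine.Simplex.dist_circumcenter_eq_circumradius ⟨![a, b, c], hindep⟩ i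
  have hao : dist a o = ρ := hdist 0
  have hbo : dist b o = ρ := hdist 1
  have hco : dist c o = ρ := hdist 2
  have hcol : ¬ Collinear ℝ {a, b, c} := affineIndependent_iff_not_collinear_set.1 hindep
  have hcol' : ¬ Collinear ℝ {b, a, c} := by rwa [Set.insert_comm]
  have hba : b ≠ a := ne₁₂_of_not_collinear hcol'
  have hca : c ≠ a := (ne₂₃_of_not_collinear hcol').symm
  have hbc : a ∉ affineSpan ℝ ({b, c} : Set (EuclideanSpace ℝ (Fin 2))) := fun h =>
    hcol (collinear_insert_of_mem_affineSpan_pair h)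
  have hπ : θ₁ + θ₂ < π := by
    rw [hsum]
    exact angle_lt_pi_of_not_collinear hcol'
  have hza : z ≠ a := by
    rintro rfl
    rw [angle_self_right] at hθ₁
    rw [angle_self_left] at hθ₂
    linarith
  have hO : ‖o - a‖ = ρ := by rw [← dist_eq_norm, dist_comm, hao]
  have key := norm_mul_angle_div_sin_add_le (x := b - a) (y := c - a) (z := z - a) (o := o - a)
    (sub_ne_zero.2 hba) (sub_ne_zero.2 hca) (sub_ne_zero.2 hza) hθ₁ hθ₂ hθ₁pos hθ₂pos hsum hπ
    (by rw [hO, sub_sub_sub_cancel_right, ← dist_eq_norm, hbo])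
    (by rw [hO, sub_sub_sub_cancel_right, ← dist_eq_norm, hco])
    (by rwa [hO, sub_sub_sub_cancel_right, ← dist_eq_norm])
    (fun p q hp hq h => by
      by_contra! hpq
      refine hside ?_
      have hm := AffineMap.lineMap_mem_affineSpan_pair (q / (p + q)) b c
      have h' : z = p • (b - a) + q • (c - a) + a := sub_eq_iff_eq_add.1 h
      have hpq0 : p + q ≠ 0 := by positivity
      have hlm : z = AffineMap.lineMap (AffineMap.lineMap b c (q / (p + q))) a (1 - (p + q)) := by
        rw [AffineMap.lineMap_apply_module, AffineMap.lineMap_apply_module, h', sub_sub_cancel,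
          smul_add, smul_smul, smul_smul, mul_sub, mul_one, mul_div_cancel₀ _ hpq0]
        module
      rw [hlm]
      exact AffineSubspace.sSameSide_lineMap_left hm hbc (sub_pos.2 hpq))
  simpa only [sub_sub_sub_cancel_right, ← dist_eq_norm] using key
end

section
/- Let a, b, c be affinely independent points of the Euclidean plane ℝ², let o be the circumcenter and ρ the circumradius of the triangle with vertices a, b, c. Let z be a point with dist z o = ρ (z lies on the circumcircle) such that z and a lie strictly on opposite sides of the line through b and c. Set θ₁ = ∠ b a z and θ₂ = ∠ z a c, and assume θ₁ > 0, θ₂ > 0 and θ₁ + θ₂ = ∠ b a c. Then dist b z · θ₁ / sin θ₁ + dist z c · θ₂ / sin θ₂ = dist b c · (θ₁ + θ₂) / sin (θ₁ + θ₂). -/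
open EuclideanGeometry Real

/-- The law of sines with unsigned angles, for three distinct points of a circle in a plane. -/
theorem EuclideanGeometry.Sphere.dist_div_sin_angle_eq_two_mul_radius {V P : Type*}
    [NormedAddCommGroup V] [InnerProductSpace ℝ V] [MetricSpace P] [NormedAddTorsor V P]
    [hd2 : Fact (Module.finrank ℝ V = 2)] {s : Sphere P} {p₁ p₂ p₃ : P}
    (hp₁ : p₁ ∈ s) (hp₂ : p₂ ∈ s) (hp₃ : p₃ ∈ s)
    (hp₁p₂ : p₁ ≠ p₂) (hp₁p₃ : p₁ ≠ p₃) (hp₂p₃ : p₂ ≠ p₃) :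
    dist p₁ p₃ / Real.sin (∠ p₁ p₂ p₃) = 2 * s.radius := by
  have : FiniteDimensional ℝ V := FiniteDimensional.of_fact_finrank_eq_two
  have : Module.Oriented ℝ V (Fin 2) :=
    ⟨Module.Basis.orientation (Module.finBasisOfFinrankEq _ _ hd2.out)⟩
  rw [← Sphere.dist_div_sin_oangle_eq_two_mul_radius hp₁ hp₂ hp₃ hp₁p₂ hp₁p₃ hp₂p₃,
    ← Real.Angle.sin_toReal,
    Real.abs_sin_eq_sin_abs_of_abs_le_pi (Real.Angle.abs_toReal_le_pi _),
    ← angle_eq_abs_oangle_toReal hp₁p₂ hp₂p₃.symm]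

/-- Equality case in Theorem D.2 of the paper: if `z` lies on the arc of the circumcircle of the
triangle `(a, b, c)` on the opposite side of the chord `bc` from `a`, the lengths of the two
sub-arcs `C^a_{bz}` and `C^a_{zc}` add up exactly to the length of `C^a_{bc}`. -/
theorem arc_length_additive_on_circle
    (a b c z : EuclideanSpace ℝ (Fin 2))
    (hindep : AffineIndependent ℝ ![a, b, c])
    (o : EuclideanSpace ℝ (Fin 2)) (ρ : ℝ)
    (ho : o = (⟨![a, b, c], hindep⟩ :
      Affine.Simplex ℝ (EuclideanSpace ℝ (Fin 2)) 2).circumcenter)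
    (hρ : ρ = (⟨![a, b, c], hindep⟩ :
      Affine.Simplex ℝ (EuclideanSpace ℝ (Fin 2)) 2).circumradius)
    (hz : dist z o = ρ)
    (hside : (affineSpan ℝ ({b, c} : Set (EuclideanSpace ℝ (Fin 2)))).SOppSide z a)
    (θ₁ θ₂ : ℝ)
    (hθ₁ : θ₁ = ∠ b a z) (hθ₂ : θ₂ = ∠ z a c)
    (hθ₁pos : 0 < θ₁) (hθ₂pos : 0 < θ₂)
    (hsum : θ₁ + θ₂ = ∠ b a c) :
    dist b z * θ₁ / Real.sin θ₁ + dist z c * θ₂ / Real.sin θ₂ =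
      dist b c * (θ₁ + θ₂) / Real.sin (θ₁ + θ₂) := by
  set t : Affine.Simplex ℝ (EuclideanSpace ℝ (Fin 2)) 2 := ⟨![a, b, c], hindep⟩
  have : Fact (Module.finrank ℝ (EuclideanSpace ℝ (Fin 2)) = 2) := ⟨by simp⟩
  have ha : a ∈ t.circumsphere := t.mem_circumsphere 0
  have hb : b ∈ t.circumsphere := t.mem_circumsphere 1
  have hc : c ∈ t.circumsphere := t.mem_circumsphere 2
  have hzs : z ∈ t.circumsphere := by
    subst ho hρ
    exact hz
  have hab : a ≠ b := hindep.injective.ne (show (0 : Fin 3) ≠ 1 by decide)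
  have hac : a ≠ c := hindep.injective.ne (show (0 : Fin 3) ≠ 2 by decide)
  have hbc : b ≠ c := hindep.injective.ne (show (1 : Fin 3) ≠ 2 by decide)
  have hzb : z ≠ b := by
    rintro rfl
    exact hside.2.1 (left_mem_affineSpan_pair ℝ _ _)
  have hzc : z ≠ c := by
    rintro rfl
    exact hside.2.1 (right_mem_affineSpan_pair ℝ _ _)
  have hza : z ≠ a := by
    rintro rfl
    exact AffineSubspace.not_sOppSide_self _ _ hside
  rw [hsum, hθ₁, hθ₂, mul_div_right_comm, mul_div_right_comm, mul_div_right_comm,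
    Sphere.dist_div_sin_angle_eq_two_mul_radius hb ha hzs hab.symm hzb.symm hza.symm,
    Sphere.dist_div_sin_angle_eq_two_mul_radius hzs ha hc hza hzc hac,
    Sphere.dist_div_sin_angle_eq_two_mul_radius hb ha hc hab.symm hbc hac,
    ← hsum, hθ₁, hθ₂, mul_add]
end

section
/- Let p, a, c be affinely independent points of the Euclidean plane ℝ², let o be the circumcenter and ρ the circumradius of the triangle with vertices p, a, c. Let z be a point with dist z o ≤ ρ such that z and p lie strictly on opposite sides of the line through a and c. Then ∠ a z c + ∠ a p c ≥ π. -/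
open EuclideanGeometry Real

/-- The signed area of the parallelogram spanned by `a - w` and `c - w` in the plane. -/
noncomputable def signedArea (a c w : EuclideanSpace ℝ (Fin 2)) : ℝ :=
  (a 0 - w 0) * (c 1 - w 1) - (a 1 - w 1) * (c 0 - w 0)

lemma mem_affineSpan_pair_of_signedArea_eq_zero {a c w : EuclideanSpace ℝ (Fin 2)} (hac : a ≠ c)
    (h : signedArea a c w = 0) : w ∈ affineSpan ℝ ({a, c} : Set (EuclideanSpace ℝ (Fin 2))) := by
  have hd : (c 0 - a 0) ^ 2 + (c 1 - a 1) ^ 2 ≠ 0 := by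
    intro h0
    apply hac
    ext i
    fin_cases i <;> simp <;> nlinarith [sq_nonneg (c 0 - a 0), sq_nonneg (c 1 - a 1)]
  unfold signedArea at h
  have key : AffineMap.lineMap a c (((w 0 - a 0) * (c 0 - a 0) + (w 1 - a 1) * (c 1 - a 1)) /
      ((c 0 - a 0) ^ 2 + (c 1 - a 1) ^ 2)) = w := by
    ext i
    fin_cases i
    · simp only [AffineMap.lineMap_apply, vsub_eq_sub, vadd_eq_add, PiLp.add_apply,
        PiLp.smul_apply, PiLp.sub_apply, smul_eq_mul, Fin.zero_eta]
      field_simp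
      linear_combination (c 1 - a 1) * h
    · simp only [AffineMap.lineMap_apply, vsub_eq_sub, vadd_eq_add, PiLp.add_apply,
        PiLp.smul_apply, PiLp.sub_apply, smul_eq_mul, Fin.mk_one]
      field_simp
      linear_combination -(c 0 - a 0) * h
  rw [← key]
  exact AffineMap.lineMap_mem_affineSpan_pair _ _ _

lemma signedArea_mul_signedArea_neg_of_sOppSide {a c z p : EuclideanSpace ℝ (Fin 2)} (hac : a ≠ c)
    (h : (affineSpan ℝ ({a, c} : Set (EuclideanSpace ℝ (Fin 2)))).SOppSide z p) :
    signedArea a c z * signedArea a c p < 0 := by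
  obtain ⟨hz, hp, q, hq, hray⟩ :=
    (AffineSubspace.sOppSide_iff_exists_left (left_mem_affineSpan_pair ℝ a c)).1 h
  have hXp : signedArea a c p ≠ 0 := mt (mem_affineSpan_pair_of_signedArea_eq_zero hac) hp
  obtain ⟨t, rfl⟩ := mem_affineSpan_pair_iff_exists_lineMap_eq.1 hq
  have hza : z -ᵥ a ≠ 0 := by
    rw [vsub_ne_zero]
    rintro rfl
    exact hz (left_mem_affineSpan_pair ℝ _ _)
  have hqp : AffineMap.lineMap a c t -ᵥ p ≠ 0 := by
    rw [vsub_ne_zero]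
    rintro rfl
    exact hp hq
  obtain ⟨r, s, hr, hs, e⟩ := hray.exists_pos hza hqp
  have e0 := congrArg (fun v : EuclideanSpace ℝ (Fin 2) => v 0) e
  have e1 := congrArg (fun v : EuclideanSpace ℝ (Fin 2) => v 1) e
  simp only [AffineMap.lineMap_apply, vsub_eq_sub, vadd_eq_add, PiLp.add_apply,
    PiLp.smul_apply, PiLp.sub_apply, smul_eq_mul] at e0 e1
  have hX : r * signedArea a c z = -(s * signedArea a c p) := by
    unfold signedArea
    linear_combination (-(c 1 - a 1)) * e0 + (c 0 - a 0) * e1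
  have h' : r * (signedArea a c z * signedArea a c p) = -(s * signedArea a c p ^ 2) := by
    linear_combination signedArea a c p * hX
  have : 0 < s * signedArea a c p ^ 2 := by positivity
  by_contra! hn
  nlinarith [mul_nonneg hr.le hn]

lemma sin_angle_mul_dist_mul_dist_eq_abs_signedArea (a c w : EuclideanSpace ℝ (Fin 2)) :
    Real.sin (∠ a w c) * (dist a w * dist c w) = |signedArea a c w| := by
  rw [EuclideanGeometry.angle, dist_eq_norm_vsub (EuclideanSpace ℝ (Fin 2)) a,
    dist_eq_norm_vsub (EuclideanSpace ℝ (Fin 2)) c,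
    InnerProductGeometry.sin_angle_mul_norm_mul_norm, ← Real.sqrt_sq_eq_abs]
  congr 1
  simp only [signedArea, PiLp.inner_apply, Fin.sum_univ_two, vsub_eq_sub, PiLp.sub_apply,
    RCLike.inner_apply, conj_trivial]
  ring

lemma cos_angle_mul_dist_mul_dist (a c w : EuclideanSpace ℝ (Fin 2)) :
    Real.cos (∠ a w c) * (dist a w * dist c w) =
      (a 0 - w 0) * (c 0 - w 0) + (a 1 - w 1) * (c 1 - w 1) := by
  rw [EuclideanGeometry.angle, dist_eq_norm_vsub (EuclideanSpace ℝ (Fin 2)) a,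
    dist_eq_norm_vsub (EuclideanSpace ℝ (Fin 2)) c,
    InnerProductGeometry.cos_angle_mul_norm_mul_norm]
  simp only [PiLp.inner_apply, Fin.sum_univ_two, vsub_eq_sub, PiLp.sub_apply,
    RCLike.inner_apply, conj_trivial]
  ring

lemma dist_sq_eq_coord (x y : EuclideanSpace ℝ (Fin 2)) :
    dist x y ^ 2 = (x 0 - y 0) ^ 2 + (x 1 - y 1) ^ 2 := by
  rw [EuclideanSpace.dist_eq, Real.sq_sqrt (by positivity), Fin.sum_univ_two, Real.dist_eq,
    Real.dist_eq, sq_abs, sq_abs]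

/-- If `a`, `c`, `p` lie on the circle of centre `o` and radius `ρ`, the incircle determinant of
`a`, `c`, `p`, `z` is the power of `z` times the signed area of the triangle `a`, `c`, `p`. -/
lemma signedArea_mul_sub_signedArea_mul_of_concyclic {a c p o : EuclideanSpace ℝ (Fin 2)} {ρ : ℝ}
    (ha : ρ ^ 2 = (a 0 - o 0) ^ 2 + (a 1 - o 1) ^ 2)
    (hc : ρ ^ 2 = (c 0 - o 0) ^ 2 + (c 1 - o 1) ^ 2)
    (hp : ρ ^ 2 = (p 0 - o 0) ^ 2 + (p 1 - o 1) ^ 2) (z : EuclideanSpace ℝ (Fin 2)) :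
    signedArea a c p * ((a 0 - z 0) * (c 0 - z 0) + (a 1 - z 1) * (c 1 - z 1)) -
        signedArea a c z * ((a 0 - p 0) * (c 0 - p 0) + (a 1 - p 1) * (c 1 - p 1)) =
      signedArea a c p * ((z 0 - o 0) ^ 2 + (z 1 - o 1) ^ 2 - ρ ^ 2) := by
  unfold signedArea
  linear_combination
    ((z 0 - p 0) * (c 1 - p 1) - (z 1 - p 1) * (c 0 - p 0)) * ha +
    ((a 0 - p 0) * (z 1 - p 1) - (a 1 - p 1) * (z 0 - p 0)) * hc +
    ((a 0 - z 0) * (c 1 - z 1) - (a 1 - z 1) * (c 0 - z 0)) * hp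

lemma mul_add_mul_nonpos_of_mul_neg {x y u v w : ℝ} (hxy : x * y < 0)
    (h : y * u - x * v = y * w) (hw : w ≤ 0) : |x| * v + u * |y| ≤ 0 := by
  rcases mul_neg_iff.1 hxy with ⟨hx, hy⟩ | ⟨hx, hy⟩
  · rw [abs_of_pos hx, abs_of_neg hy]
    linarith [mul_nonneg_of_nonpos_of_nonpos hy.le hw]
  · rw [abs_of_neg hx, abs_of_pos hy]
    linarith [mul_nonpos_of_nonneg_of_nonpos hy.le hw]

lemma pi_le_angle_add_angle_of_dist_le {a c z p o : EuclideanSpace ℝ (Fin 2)} {ρ : ℝ}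
    (ha : dist a o = ρ) (hc : dist c o = ρ) (hp : dist p o = ρ) (hz : dist z o ≤ ρ)
    (hneg : signedArea a c z * signedArea a c p < 0) :
    π ≤ ∠ a z c + ∠ a p c := by
  have hXz : signedArea a c z ≠ 0 := left_ne_zero_of_mul hneg.ne
  have hXp : signedArea a c p ≠ 0 := right_ne_zero_of_mul hneg.ne
  have sz := sin_angle_mul_dist_mul_dist_eq_abs_signedArea a c z
  have sp := sin_angle_mul_dist_mul_dist_eq_abs_signedArea a c p
  have cz := cos_angle_mul_dist_mul_dist a c z
  have cp := cos_angle_mul_dist_mul_dist a c p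
  have hNz : 0 < dist a z * dist c z := by
    refine lt_of_le_of_ne (by positivity) fun h0 => abs_ne_zero.2 hXz ?_
    rw [← sz, ← h0, mul_zero]
  have hNp : 0 < dist a p * dist c p := by
    refine lt_of_le_of_ne (by positivity) fun h0 => abs_ne_zero.2 hXp ?_
    rw [← sp, ← h0, mul_zero]
  have hsp : Real.sin (∠ a p c) ≠ 0 := by
    intro h0
    rw [h0, zero_mul] at sp
    exact abs_ne_zero.2 hXp sp.symm
  have hangle : 0 < ∠ a p c :=
    lt_of_le_of_ne (EuclideanGeometry.angle_nonneg _ _ _) fun h0 => hsp (by rw [← h0, Real.sin_zero])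
  have pz : dist z o ^ 2 ≤ ρ ^ 2 := by gcongr
  have pa := dist_sq_eq_coord a o
  have pc := dist_sq_eq_coord c o
  have pp := dist_sq_eq_coord p o
  rw [ha] at pa
  rw [hc] at pc
  rw [hp] at pp
  rw [dist_sq_eq_coord] at pz
  have hid := signedArea_mul_sub_signedArea_mul_of_concyclic pa pc pp z
  have hmain := mul_add_mul_nonpos_of_mul_neg hneg hid (sub_nonpos.2 pz)
  by_contra! hlt
  have hpos := Real.sin_pos_of_pos_of_lt_pi
    (add_pos_of_nonneg_of_pos (EuclideanGeometry.angle_nonneg a z c) hangle) hlt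
  rw [Real.sin_add] at hpos
  rw [← sz, ← sp, ← cz, ← cp] at hmain
  have := mul_pos hpos (mul_pos hNz hNp)
  linarith

/-- **Lemma 3.5 (paper), geometric core:** if `z` lies inside (or on) the circumcircle of the
triangle `(p, a, c)`, in the region cut off by the chord `ac` not containing `p`, then the angle
subtended by `a` and `c` at `z` is at least the supplement of the angle at `p`. -/
theorem angle_add_angle_ge_pi_of_mem_circumball
    (p a c z : EuclideanSpace ℝ (Fin 2))
    (hindep : AffineIndependent ℝ ![p, a, c])
    (o : EuclideanSpace ℝ (Fin 2)) (ρ : ℝ)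
    (ho : o = (⟨![p, a, c], hindep⟩ :
      Affine.Simplex ℝ (EuclideanSpace ℝ (Fin 2)) 2).circumcenter)
    (hρ : ρ = (⟨![p, a, c], hindep⟩ :
      Affine.Simplex ℝ (EuclideanSpace ℝ (Fin 2)) 2).circumradius)
    (hz : dist z o ≤ ρ)
    (hside : (affineSpan ℝ ({a, c} : Set (EuclideanSpace ℝ (Fin 2)))).SOppSide z p) :
    π ≤ ∠ a z c + ∠ a p c := by
  set T : Affine.Simplex ℝ (EuclideanSpace ℝ (Fin 2)) 2 := ⟨![p, a, c], hindep⟩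
  have hac : a ≠ c := fun h => absurd (hindep.injective (a₁ := 1) (a₂ := 2) h) (by decide)
  subst ho hρ
  exact pi_le_angle_add_angle_of_dist_le (T.dist_circumcenter_eq_circumradius 1)
    (T.dist_circumcenter_eq_circumradius 2) (T.dist_circumcenter_eq_circumradius 0) hz
    (signedArea_mul_signedArea_neg_of_sOppSide hac hside)
end

section
/- Let θ₁, θ₂ be real numbers with 0 < θ₁, 0 < θ₂ and θ₁ + θ₂ < π, and let h₁, h₂ ≥ 0. Then h₁ · θ₁ / sin θ₁ + h₂ · θ₂ / sin θ₂ ≤ (h₁ + h₂) · (θ₁ + θ₂) / sin (θ₁ + θ₂). -/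
open Real

theorem strictMonoOn_div_sin : StrictMonoOn (fun x : ℝ => x / Real.sin x) (Set.Ioo 0 π) := by
  rintro x ⟨hx₀, hxπ⟩ y ⟨hy₀, hyπ⟩ hxy
  have h := strictConcaveOn_sin_Icc.secant_strict_mono (a := 0) ⟨le_rfl, pi_pos.le⟩
    ⟨hx₀.le, hxπ.le⟩ ⟨hy₀.le, hyπ.le⟩ hx₀.ne' hy₀.ne' hxy
  simp only [Real.sin_zero, sub_zero] at h
  simpa only [inv_div] using inv_strictAnti₀ (div_pos (sin_pos_of_pos_of_lt_pi hy₀ hyπ) hy₀) h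

/-- Inequality (E3) in the proof of Theorem D.2 of the paper. -/
theorem chord_arc_sum_le
    (θ₁ θ₂ h₁ h₂ : ℝ)
    (hθ₁ : 0 < θ₁) (hθ₂ : 0 < θ₂) (hsum : θ₁ + θ₂ < π)
    (hh₁ : 0 ≤ h₁) (hh₂ : 0 ≤ h₂) :
    h₁ * θ₁ / Real.sin θ₁ + h₂ * θ₂ / Real.sin θ₂ ≤
      (h₁ + h₂) * (θ₁ + θ₂) / Real.sin (θ₁ + θ₂) := by
  have hmem : θ₁ + θ₂ ∈ Set.Ioo 0 π := ⟨by linarith, hsum⟩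
  have hle₁ : θ₁ / Real.sin θ₁ ≤ (θ₁ + θ₂) / Real.sin (θ₁ + θ₂) :=
    strictMonoOn_div_sin.monotoneOn ⟨hθ₁, by linarith⟩ hmem (by linarith)
  have hle₂ : θ₂ / Real.sin θ₂ ≤ (θ₁ + θ₂) / Real.sin (θ₁ + θ₂) :=
    strictMonoOn_div_sin.monotoneOn ⟨hθ₂, by linarith⟩ hmem (by linarith)
  rw [mul_div_assoc, mul_div_assoc, mul_div_assoc, add_mul]
  gcongr
end
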